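/- Let $(X_0,X_1)$ be an interpolation couple, $s_0\in(0,1)$, $p_0,p_1\in(1,\infty)$, $\gamma_0\in(-1,p_0-1)$, $\gamma_1\in(-1,p_1-1)$. Set $\delta_0=s_0-\frac{1+\gamma_0}{p_0}$, $\delta_1=-\frac{1+\gamma_1}{p_1}$ and assume $\delta_0>0$; let $\theta=\delta_0/(\delta_0-\delta_1)$ and $1/p=(1-\theta)/p_0+\theta/p_1$. Then for every $u\in \mathscr{S}(\mathbb{R};X_0\cap X_1)$, $\|u(0)\|_{(X_0,X_1)_{\theta,p}} \lesssim \big([u]^{(1)}_{F^{s_0}_{p_0,p_0}(\mathbb{R}_+,w_{\gamma_0};X_0)}\big)^{1-\theta}\,\|u\|_{L^{p_1}(\mathbb{R}_+,w_{\gamma_1};X_1)}^{\theta}$. -/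

import Mathlib

open MeasureTheory Set ENNReal

noncomputable section

variable {X0 X1 V : Type*}
  [NormedAddCommGroup X0] [NormedSpace ℝ X0]
  [NormedAddCommGroup X1] [NormedSpace ℝ X1]
  [AddCommGroup V] [Module ℝ V]

/-- The K-functional of the interpolation couple `(X0, X1)`, realized via linear
injections into a common space `V`. -/
def Kfun (i0 : X0 →ₗ[ℝ] V) (i1 : X1 →ₗ[ℝ] V) (t : ℝ) (x : V) : ℝ≥0∞ :=
  ⨅ (y : X0) (z : X1) (_ : x = i0 y + i1 z),
    (‖y‖₊ : ℝ≥0∞) + ENNReal.ofReal t * (‖z‖₊ : ℝ≥0∞)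

/-- The (extended) norm of the real interpolation space `(X0, X1)_{θ,p}` (K-method). -/
def interpNorm (i0 : X0 →ₗ[ℝ] V) (i1 : X1 →ₗ[ℝ] V) (θ p : ℝ) (x : V) : ℝ≥0∞ :=
  (∫⁻ t in Ioi (0:ℝ),
      (ENNReal.ofReal (t ^ (-θ)) * Kfun i0 i1 t x) ^ p * (ENNReal.ofReal t)⁻¹) ^ (1 / p)

/-- The mean of the first-order difference
`d¹_τ u(t) = τ⁻¹ ∫_{|h|<τ, t+h>0} ‖u(t+h) - u(t)‖ dh`. -/
def d1mean (u : ℝ → X0) (τ t : ℝ) : ℝ≥0∞ :=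
  ENNReal.ofReal τ⁻¹ *
    ∫⁻ h in {h : ℝ | |h| < τ ∧ 0 < t + h}, (‖u (t + h) - u t‖₊ : ℝ≥0∞)

/-- The difference seminorm `[u]^{(1)}_{F^{s}_{p,p}(ℝ_+, w_γ; X0)}`. -/
def diffSeminormF (s p γ : ℝ) (u : ℝ → X0) : ℝ≥0∞ :=
  (∫⁻ t in Ioi (0:ℝ), ENNReal.ofReal (t ^ γ) *
      (∫⁻ τ in Ioi (0:ℝ),
        (ENNReal.ofReal (τ ^ (-s)) * d1mean u τ t) ^ p * (ENNReal.ofReal τ)⁻¹)) ^ (1 / p)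

/-- The weighted norm of `L^{p}(ℝ_+, w_γ; X1)`. -/
def wLpNorm (p γ : ℝ) (u : ℝ → X1) : ℝ≥0∞ :=
  (∫⁻ t in Ioi (0:ℝ), ENNReal.ofReal (t ^ γ) * (‖u t‖₊ : ℝ≥0∞) ^ p) ^ (1 / p)


lemma aux_jensen {α : Type*} [MeasurableSpace α] (μ : Measure α) [IsProbabilityMeasure μ]
    {p : ℝ} (hp : 1 ≤ p) {f : α → ℝ≥0∞} (hf : AEMeasurable f μ) :
    (∫⁻ a, f a ∂μ) ^ p ≤ ∫⁻ a, f a ^ p ∂μ := by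
  have hp0 : 0 < p := by linarith
  have h := ENNReal.lintegral_mul_norm_pow_le (μ := μ) (f := fun a => f a ^ p) (g := fun _ => 1)
    (hf.pow_const p) aemeasurable_const (p := 1 / p) (q := 1 - 1 / p) (by positivity)
    (by rw [sub_nonneg, div_le_one hp0]; exact hp) (by ring)
  simp only [← ENNReal.rpow_mul, mul_one_div_cancel hp0.ne', ENNReal.rpow_one, ENNReal.one_rpow,
    mul_one, lintegral_const, measure_univ] at h
  calc _ ≤ _ := ENNReal.rpow_le_rpow h hp0.le
    _ = _ := by rw [← ENNReal.rpow_mul, one_div_mul_cancel hp0.ne', ENNReal.rpow_one]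

lemma aux_cross {F G : ℤ → ℝ≥0∞} {K ρ : ℝ≥0∞} (hρ : ρ ≠ ⊤) (hK : ∀ k, K ≤ F k + ρ * G k)
    (hF : Filter.Tendsto F Filter.atBot (nhds 0)) (hG : Filter.Tendsto G Filter.atTop (nhds 0))
    {p : ℝ} (hp : 0 < p) :
    K ^ p ≤ ∑' k, (2 * min (F (k + 1)) (ρ * G k)) ^ p := by
  by_cases hc : ∃ k, F k ≤ ρ * G k ∧ ρ * G (k + 1) < F (k + 1)
  · obtain ⟨k, h1, h2⟩ := hc
    refine le_trans (ENNReal.rpow_le_rpow ?_ hp.le) (ENNReal.le_tsum k)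
    rcases le_total (F (k + 1)) (ρ * G k) with h | h
    · rw [min_eq_left h, two_mul]
      exact (hK (k + 1)).trans (by gcongr)
    · rw [min_eq_right h, two_mul]
      exact (hK k).trans (by gcongr)
  · push Not at hc
    have : K = 0 := by
      by_cases hS : ∃ k, F k ≤ ρ * G k
      · obtain ⟨k, hk⟩ := hS
        have hall : ∀ j, k ≤ j → F j ≤ ρ * G j := by
          intro j hj
          induction j, hj using Int.leInduction with
          | base => exact hk
          | succ n hn ih => exact hc n ih
        have hl : Filter.Tendsto (fun j => 2 * (ρ * G j)) Filter.atTop (nhds 0) := by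
          have h1 := ENNReal.Tendsto.const_mul (a := ρ) hG (Or.inr hρ)
          have h2 := ENNReal.Tendsto.const_mul (a := 2) h1 (Or.inr (by simp))
          simpa using h2
        refine le_antisymm (ge_of_tendsto hl ?_) bot_le
        filter_upwards [Filter.eventually_ge_atTop k] with j hj
        rw [two_mul]
        exact (hK j).trans (by gcongr; exact hall j hj)
      · push Not at hS
        have hl : Filter.Tendsto (fun j => 2 * F j) Filter.atBot (nhds 0) := by
          have h2 := ENNReal.Tendsto.const_mul (a := 2) hF (Or.inr (by simp))
          simpa using h2
        refine le_antisymm (ge_of_tendsto hl ?_) bot_le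
        filter_upwards with j
        rw [two_mul]
        exact (hK j).trans (by gcongr; exact (hS j).le)
    rw [this, ENNReal.zero_rpow_of_pos hp]
    exact bot_le

lemma aux_min_int {θ p : ℝ} (hθ0 : 0 < θ) (hθ1 : θ < 1) (hp : 0 < p) :
    ∃ C : ℝ≥0∞, C ≠ ⊤ ∧ ∀ F G : ℝ≥0∞, F ≠ ⊤ → G ≠ ⊤ →
      ∫⁻ r in Ioi (0:ℝ), (ENNReal.ofReal (r ^ (-θ)) * min F (ENNReal.ofReal r * G)) ^ p
        * (ENNReal.ofReal r)⁻¹ ≤ C * (F ^ ((1 - θ) * p) * G ^ (θ * p)) := by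
  have hA : 0 < (1 - θ) * p := mul_pos (by linarith) hp
  have hB : 0 < θ * p := mul_pos hθ0 hp
  refine ⟨ENNReal.ofReal (1 / ((1 - θ) * p) + 1 / (θ * p)), ENNReal.ofReal_ne_top, ?_⟩
  intro F G hF hG
  by_cases hF0 : F = 0
  · simp [hF0, ENNReal.zero_rpow_of_pos hp]
  by_cases hG0 : G = 0
  · simp [hG0, ENNReal.zero_rpow_of_pos hp]
  obtain ⟨f, hf, rfl⟩ : ∃ f : ℝ, 0 < f ∧ F = ENNReal.ofReal f :=
    ⟨F.toReal, ENNReal.toReal_pos hF0 hF, (ENNReal.ofReal_toReal hF).symm⟩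
  obtain ⟨g, hg, rfl⟩ : ∃ g : ℝ, 0 < g ∧ G = ENNReal.ofReal g :=
    ⟨G.toReal, ENNReal.toReal_pos hG0 hG, (ENNReal.ofReal_toReal hG).symm⟩
  set R := f / g with hR
  have hRpos : 0 < R := div_pos hf hg
  rw [← Ioc_union_Ioi_eq_Ioi hRpos.le]
  refine (lintegral_union_le _ _ _).trans ?_
  have e1 : ∫⁻ r in Ioc 0 R, (ENNReal.ofReal (r ^ (-θ)) * min (ENNReal.ofReal f)
      (ENNReal.ofReal r * ENNReal.ofReal g)) ^ p * (ENNReal.ofReal r)⁻¹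
      ≤ ENNReal.ofReal (f ^ ((1 - θ) * p) * g ^ (θ * p) * (1 / ((1 - θ) * p))) := by
    calc _ ≤ ∫⁻ r in Ioc 0 R, ENNReal.ofReal (g ^ p * r ^ ((1 - θ) * p - 1)) := by
          refine setLIntegral_mono' measurableSet_Ioc fun r hr => ?_
          have hr0 : 0 < r := hr.1
          calc _ ≤ (ENNReal.ofReal (r ^ (-θ)) * (ENNReal.ofReal r * ENNReal.ofReal g)) ^ p
                * (ENNReal.ofReal r)⁻¹ := by gcongr; exact min_le_right _ _
            _ = _ := by
              rw [← ENNReal.ofReal_mul hr0.le, ← ENNReal.ofReal_mul (by positivity),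
                ENNReal.ofReal_rpow_of_pos (by positivity), ← ENNReal.ofReal_inv_of_pos hr0,
                ← ENNReal.ofReal_mul (by positivity)]
              congr 1
              rw [Real.mul_rpow (by positivity) (by positivity), Real.mul_rpow hr0.le hg.le,
                ← Real.rpow_mul hr0.le, show (1 - θ) * p - 1 = -θ * p + p + (-1) by ring,
                Real.rpow_add hr0, Real.rpow_add hr0, Real.rpow_neg_one]
              ring
      _ = ENNReal.ofReal (∫ r in Ioc 0 R, g ^ p * r ^ ((1 - θ) * p - 1)) := by
          rw [ofReal_integral_eq_lintegral_ofReal]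
          · apply Integrable.const_mul
            have := (intervalIntegral.intervalIntegrable_rpow' (a := 0) (b := R)
              (r := (1 - θ) * p - 1) (by linarith))
            rwa [intervalIntegrable_iff_integrableOn_Ioc_of_le hRpos.le] at this
          · refine (ae_restrict_iff' measurableSet_Ioc).2 (Filter.Eventually.of_forall fun r hr => ?_)
            have hr0 : 0 < r := hr.1
            positivity
      _ ≤ _ := by
          apply le_of_eq
          congr 1
          rw [integral_const_mul, ← intervalIntegral.integral_of_le hRpos.le,
            integral_rpow (Or.inl (by linarith)), sub_add_cancel, Real.zero_rpow hA.ne', sub_zero,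
            hR, Real.div_rpow hf.le hg.le, show p = (1 - θ) * p + θ * p by ring, Real.rpow_add hg]
          rw [show (1 - θ) * p + θ * p = p by ring]
          have : 0 < g ^ ((1 - θ) * p) := by positivity
          field_simp
  have e2 : ∫⁻ r in Ioi R, (ENNReal.ofReal (r ^ (-θ)) * min (ENNReal.ofReal f)
      (ENNReal.ofReal r * ENNReal.ofReal g)) ^ p * (ENNReal.ofReal r)⁻¹
      ≤ ENNReal.ofReal (f ^ ((1 - θ) * p) * g ^ (θ * p) * (1 / (θ * p))) := by
    calc _ ≤ ∫⁻ r in Ioi R, ENNReal.ofReal (f ^ p * r ^ (-(θ * p) - 1)) := by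
          refine setLIntegral_mono' measurableSet_Ioi fun r hr => ?_
          have hr0 : 0 < r := hRpos.trans hr
          calc _ ≤ (ENNReal.ofReal (r ^ (-θ)) * (ENNReal.ofReal f)) ^ p
                * (ENNReal.ofReal r)⁻¹ := by gcongr; exact min_le_left _ _
            _ = _ := by
              rw [← ENNReal.ofReal_mul (by positivity),
                ENNReal.ofReal_rpow_of_pos (by positivity), ← ENNReal.ofReal_inv_of_pos hr0,
                ← ENNReal.ofReal_mul (by positivity)]
              congr 1
              rw [Real.mul_rpow (by positivity) (by positivity),
                ← Real.rpow_mul hr0.le, show -(θ * p) - 1 = -θ * p + (-1) by ring,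
                Real.rpow_add hr0, Real.rpow_neg_one]
              ring
      _ = ENNReal.ofReal (∫ r in Ioi R, f ^ p * r ^ (-(θ * p) - 1)) := by
          rw [ofReal_integral_eq_lintegral_ofReal]
          · apply Integrable.const_mul
            exact integrableOn_Ioi_rpow_of_lt (by linarith) hRpos
          · refine (ae_restrict_iff' measurableSet_Ioi).2 (Filter.Eventually.of_forall fun r hr => ?_)
            have hr0 : 0 < r := hRpos.trans hr
            positivity
      _ ≤ _ := by
          apply le_of_eq
          congr 1
          rw [integral_const_mul, integral_Ioi_rpow_of_lt (by linarith) hRpos, sub_add_cancel,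
            hR, Real.div_rpow hf.le hg.le, Real.rpow_neg hf.le, Real.rpow_neg hg.le,
            show f ^ p = f ^ ((1 - θ) * p) * f ^ (θ * p) by rw [← Real.rpow_add hf]; ring_nf]
          have : 0 < g ^ (θ * p) := by positivity
          have : 0 < f ^ (θ * p) := by positivity
          field_simp
  refine (add_le_add e1 e2).trans (le_of_eq ?_)
  rw [ENNReal.ofReal_rpow_of_pos hf, ENNReal.ofReal_rpow_of_pos hg,
    ← ENNReal.ofReal_mul (by positivity), ← ENNReal.ofReal_mul (by positivity),
    ← ENNReal.ofReal_add (by positivity) (by positivity)]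
  congr 1
  ring

lemma aux_two_ne_zero : (2:ℝ≥0∞) ≠ 0 := by simp
lemma aux_two_ne_top : (2:ℝ≥0∞) ≠ ⊤ := by simp
lemma aux_two_rpow_ne_top (x : ℝ) : (2:ℝ≥0∞) ^ x ≠ ⊤ := by
  simp [ENNReal.rpow_eq_top_iff]
lemma aux_two_rpow_ne_zero (x : ℝ) : (2:ℝ≥0∞) ^ x ≠ 0 := by
  simp [ENNReal.rpow_eq_zero_iff]
lemma aux_two_add (x y : ℝ) : (2:ℝ≥0∞) ^ x * 2 ^ y = 2 ^ (x + y) :=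
  (ENNReal.rpow_add _ _ aux_two_ne_zero aux_two_ne_top).symm
lemma aux_two_ofReal (x : ℝ) : ENNReal.ofReal ((2:ℝ) ^ x) = (2:ℝ≥0∞) ^ x := by
  rw [← ENNReal.ofReal_rpow_of_pos (by norm_num)]; simp

lemma aux_abs {δ0 δ1 θ p p0 p1 : ℝ} (hθ0 : 0 < θ) (hθ1 : θ < 1) (hp0 : 0 < p0) (hp1 : 0 < p1)
    (hp : 0 < p) (hδ : (1 - θ) * δ0 + θ * δ1 = 0) (hpp : 1 / p = (1 - θ) / p0 + θ / p1) :
    ∃ C : ℝ≥0∞, C ≠ ⊤ ∧ ∀ (K : ℝ → ℝ≥0∞) (F G : ℤ → ℝ≥0∞), (∀ k, F k ≠ ⊤) → (∀ k, G k ≠ ⊤) →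
      Filter.Tendsto F Filter.atBot (nhds 0) → Filter.Tendsto G Filter.atTop (nhds 0) →
      (∀ r k, K r ≤ F k + ENNReal.ofReal r * G k) →
      (∫⁻ r in Ioi (0:ℝ), (ENNReal.ofReal (r ^ (-θ)) * K r) ^ p * (ENNReal.ofReal r)⁻¹) ^ (1 / p)
       ≤ C * (∑' k : ℤ, ((2:ℝ≥0∞) ^ (-δ0 * k) * F k) ^ p0) ^ ((1 - θ) / p0)
          * (∑' k : ℤ, ((2:ℝ≥0∞) ^ (-δ1 * k) * G k) ^ p1) ^ (θ / p1) := by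
  obtain ⟨C, hC, hmin⟩ := aux_min_int hθ0 hθ1 hp
  have hA : 0 < (1 - θ) * p := mul_pos (by linarith) hp
  have hB : 0 < θ * p := mul_pos hθ0 hp
  refine ⟨((2:ℝ≥0∞) ^ p * C * 2 ^ (δ0 * ((1 - θ) * p))) ^ (1 / p), ?_, ?_⟩
  · refine ENNReal.rpow_ne_top_of_nonneg (by positivity) ?_
    exact ENNReal.mul_ne_top (ENNReal.mul_ne_top (aux_two_rpow_ne_top _) hC) (aux_two_rpow_ne_top _)
  intro K F G hF hG hF0 hG0 hK
  set SA := ∑' k : ℤ, ((2:ℝ≥0∞) ^ (-δ0 * k) * F k) ^ p0 with hSA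
  set SB := ∑' k : ℤ, ((2:ℝ≥0∞) ^ (-δ1 * k) * G k) ^ p1 with hSB
  have step1 : ∫⁻ r in Ioi (0:ℝ), (ENNReal.ofReal (r ^ (-θ)) * K r) ^ p * (ENNReal.ofReal r)⁻¹
      ≤ ∑' k : ℤ, (2:ℝ≥0∞) ^ p * (C * (F (k + 1) ^ ((1 - θ) * p) * G k ^ (θ * p))) := by
    calc _ ≤ ∫⁻ r in Ioi (0:ℝ), ∑' k : ℤ, (2:ℝ≥0∞) ^ p * ((ENNReal.ofReal (r ^ (-θ)) *
            min (F (k + 1)) (ENNReal.ofReal r * G k)) ^ p * (ENNReal.ofReal r)⁻¹) := by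
          refine lintegral_mono fun r => ?_
          have := aux_cross (F := F) (G := G) (ENNReal.ofReal_ne_top) (hK r) hF0 hG0 hp
          rw [ENNReal.mul_rpow_of_nonneg _ _ hp.le]
          refine (mul_le_mul' (mul_le_mul' le_rfl this) le_rfl).trans (le_of_eq ?_)
          rw [← ENNReal.tsum_mul_left, ← ENNReal.tsum_mul_right]
          congr 1 with k
          rw [ENNReal.mul_rpow_of_nonneg _ _ hp.le, ENNReal.mul_rpow_of_nonneg _ _ hp.le]
          ring
      _ = ∑' k : ℤ, ∫⁻ r in Ioi (0:ℝ), (2:ℝ≥0∞) ^ p * ((ENNReal.ofReal (r ^ (-θ)) *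
            min (F (k + 1)) (ENNReal.ofReal r * G k)) ^ p * (ENNReal.ofReal r)⁻¹) := by
          rw [lintegral_tsum]
          intro k
          apply Measurable.aemeasurable
          fun_prop
      _ ≤ _ := by
          refine ENNReal.tsum_le_tsum fun k => ?_
          rw [lintegral_const_mul' _ _ (aux_two_rpow_ne_top _)]
          gcongr
          exact hmin _ _ (hF _) (hG _)
  set α := (1 - θ) * p / p0 with hα
  set β := θ * p / p1 with hβ
  have hαβ : α + β = 1 := by
    have : α + β = p * ((1 - θ) / p0 + θ / p1) := by rw [hα, hβ]; ring
    rw [this, ← hpp]; field_simp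
  have step2 : ∑' k : ℤ, (2:ℝ≥0∞) ^ p * (C * (F (k + 1) ^ ((1 - θ) * p) * G k ^ (θ * p)))
      ≤ (2:ℝ≥0∞) ^ p * C * 2 ^ (δ0 * ((1 - θ) * p)) * (SA ^ α * SB ^ β) := by
    calc _ = ∑' k : ℤ, (2:ℝ≥0∞) ^ p * C * 2 ^ (δ0 * ((1 - θ) * p)) *
          ((((2:ℝ≥0∞) ^ (-δ0 * ((k + 1 : ℤ) : ℝ)) * F (k + 1)) ^ p0) ^ α *
            (((2:ℝ≥0∞) ^ (-δ1 * k) * G k) ^ p1) ^ β) := by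
          congr 1 with k
          rw [← ENNReal.rpow_mul, ← ENNReal.rpow_mul, hα, hβ, mul_div_cancel₀ _ hp0.ne',
            mul_div_cancel₀ _ hp1.ne', ENNReal.mul_rpow_of_nonneg _ _ hA.le,
            ENNReal.mul_rpow_of_nonneg _ _ hB.le, ← ENNReal.rpow_mul, ← ENNReal.rpow_mul]
          have : (2:ℝ≥0∞) ^ (δ0 * ((1 - θ) * p)) * (2 ^ (-δ0 * ((k + 1 : ℤ) : ℝ) * ((1 - θ) * p))
              * 2 ^ (-δ1 * k * (θ * p))) = 1 := by
            rw [aux_two_add, aux_two_add]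
            have : δ0 * ((1 - θ) * p) + (-δ0 * ((k + 1 : ℤ) : ℝ) * ((1 - θ) * p)
              + -δ1 * k * (θ * p)) = 0 := by
              push_cast
              linear_combination (-(k:ℝ) * p) * hδ
            rw [this, ENNReal.rpow_zero]
          calc _ = (2:ℝ≥0∞) ^ p * (C * (F (k + 1) ^ ((1 - θ) * p) * G k ^ (θ * p))) * 1 := by ring
            _ = _ := by rw [← this]; ring
      _ ≤ _ := by
          rw [ENNReal.tsum_mul_left]
          gcongr
          have h := ENNReal.lintegral_mul_norm_pow_le (μ := Measure.count (α := ℤ))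
            (f := fun k : ℤ => ((2:ℝ≥0∞) ^ (-δ0 * ((k + 1 : ℤ) : ℝ)) * F (k + 1)) ^ p0)
            (g := fun k : ℤ => ((2:ℝ≥0∞) ^ (-δ1 * k) * G k) ^ p1)
            (measurable_from_top.aemeasurable) (measurable_from_top.aemeasurable)
            (p := α) (q := β) (by positivity) (by positivity) hαβ
          rw [lintegral_count, lintegral_count, lintegral_count] at h
          refine h.trans (le_of_eq ?_)
          rw [hSA, hSB]
          congr 2
          exact (Equiv.addRight (1:ℤ)).tsum_eq (fun k : ℤ => ((2:ℝ≥0∞) ^ (-δ0 * k) * F k) ^ p0)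
  calc _ ≤ ((2:ℝ≥0∞) ^ p * C * 2 ^ (δ0 * ((1 - θ) * p)) * (SA ^ α * SB ^ β)) ^ (1 / p) :=
        ENNReal.rpow_le_rpow (step1.trans step2) (by positivity)
    _ = _ := by
      have hp' : (0:ℝ) ≤ 1 / p := by positivity
      rw [ENNReal.mul_rpow_of_nonneg _ _ hp', ENNReal.mul_rpow_of_nonneg (SA ^ α) _ hp',
        ← ENNReal.rpow_mul, ← ENNReal.rpow_mul, ← mul_assoc,
        show α * (1 / p) = (1 - θ) / p0 by rw [hα]; field_simp,
        show β * (1 / p) = θ / p1 by rw [hβ]; field_simp]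

/-- normalized Lebesgue measure on a dyadic interval -/
def dyI (k : ℤ) : Set ℝ := Ico ((2:ℝ) ^ (k:ℝ)) ((2:ℝ) ^ ((k:ℝ) + 1))

def dyM (k : ℤ) : Measure ℝ := (2:ℝ≥0∞) ^ (-(k:ℝ)) • volume.restrict (dyI k)

lemma dyI_meas (k : ℤ) : MeasurableSet (dyI k) := measurableSet_Ico

lemma dyI_vol (k : ℤ) : volume (dyI k) = (2:ℝ≥0∞) ^ (k:ℝ) := by
  rw [dyI, Real.volume_Ico, Real.rpow_add (by norm_num), Real.rpow_one, ← aux_two_ofReal]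
  congr 1; ring

instance dyM_prob (k : ℤ) : IsProbabilityMeasure (dyM k) := by
  constructor
  simp only [dyM, Measure.smul_apply, Measure.restrict_apply_univ, dyI_vol, smul_eq_mul]
  rw [aux_two_add]; simp

lemma dyM_int (k : ℤ) (f : ℝ → ℝ≥0∞) :
    ∫⁻ t, f t ∂(dyM k) = (2:ℝ≥0∞) ^ (-(k:ℝ)) * ∫⁻ t in dyI k, f t := by
  rw [dyM, lintegral_smul_measure, smul_eq_mul]

lemma dyM_int' (k : ℤ) (f : ℝ → ℝ≥0∞) :
    ∫⁻ t in dyI k, f t = (2:ℝ≥0∞) ^ (k:ℝ) * ∫⁻ t, f t ∂(dyM k) := by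
  rw [dyM_int, ← mul_assoc, aux_two_add]; simp

lemma dyM_ae {k : ℤ} {P : ℝ → Prop} (h : ∀ t ∈ dyI k, P t) : ∀ᵐ t ∂(dyM k), P t := by
  apply Measure.ae_smul_measure
  exact (ae_restrict_iff' (dyI_meas k)).2 (Filter.Eventually.of_forall h)

lemma dyI_pos {k : ℤ} {t : ℝ} (h : t ∈ dyI k) : 0 < t :=
  lt_of_lt_of_le (by positivity) h.1

lemma dyI_disj : Pairwise (Function.onFun Disjoint dyI) := by
  have key : ∀ i j : ℤ, i < j → Disjoint (dyI i) (dyI j) := by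
    intro i j hij
    rw [Set.disjoint_left]
    intro t ht ht'
    have h1 : (2:ℝ) ^ ((i:ℝ) + 1) ≤ (2:ℝ) ^ (j:ℝ) :=
      Real.rpow_le_rpow_of_exponent_le (by norm_num) (by exact_mod_cast hij)
    exact absurd (ht.2.trans_le h1) (not_lt.2 ht'.1)
  intro i j hij
  rcases lt_or_gt_of_ne hij with h | h
  · exact key i j h
  · exact (key j i h).symm

lemma aux_weight (γ : ℝ) (φ : ℝ → ℝ≥0∞) :
    ∑' k : ℤ, (2:ℝ≥0∞) ^ ((γ + 1) * k) * ∫⁻ t, φ t ∂(dyM k)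
      ≤ (2:ℝ≥0∞) ^ |γ| * ∫⁻ t in Ioi (0:ℝ), ENNReal.ofReal (t ^ γ) * φ t := by
  calc _ ≤ ∑' k : ℤ, (2:ℝ≥0∞) ^ |γ| * ∫⁻ t in dyI k, ENNReal.ofReal (t ^ γ) * φ t := by
        refine ENNReal.tsum_le_tsum fun k => ?_
        rw [add_mul, one_mul, ← aux_two_add, mul_assoc, ← dyM_int',
          ← lintegral_const_mul' _ _ (aux_two_rpow_ne_top _),
          ← lintegral_const_mul' _ _ (aux_two_rpow_ne_top _)]
        refine setLIntegral_mono' (dyI_meas k) fun t ht => ?_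
        rw [← mul_assoc]
        gcongr
        have ht0 := dyI_pos ht
        rw [← aux_two_ofReal, ← aux_two_ofReal, ← ENNReal.ofReal_mul (by positivity)]
        apply ENNReal.ofReal_le_ofReal
        rcases le_total 0 γ with hγ | hγ
        · calc (2:ℝ) ^ (γ * k) = ((2:ℝ) ^ (k:ℝ)) ^ γ := by
                rw [← Real.rpow_mul (by norm_num), mul_comm]
            _ ≤ t ^ γ := Real.rpow_le_rpow (by positivity) ht.1 hγ
            _ ≤ _ := by
                refine le_mul_of_one_le_left (by positivity) ?_
                exact Real.one_le_rpow (by norm_num) (abs_nonneg _)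
        · have : ((2:ℝ) ^ ((k:ℝ) + 1)) ^ γ ≤ t ^ γ :=
            Real.rpow_le_rpow_of_nonpos ht0 ht.2.le hγ
          rw [abs_of_nonpos hγ]
          calc (2:ℝ) ^ (γ * k) = (2:ℝ) ^ (-γ) * ((2:ℝ) ^ ((k:ℝ) + 1)) ^ γ := by
                rw [← Real.rpow_mul (by norm_num), ← Real.rpow_add (by norm_num)]; congr 1; ring
            _ ≤ _ := by gcongr
    _ = (2:ℝ≥0∞) ^ |γ| * ∫⁻ t in ⋃ k, dyI k, ENNReal.ofReal (t ^ γ) * φ t := by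
        rw [ENNReal.tsum_mul_left, lintegral_iUnion dyI_meas dyI_disj]
    _ ≤ _ := by
        gcongr
        exact Set.iUnion_subset fun k t ht => dyI_pos ht

lemma aux_hardy {δ p : ℝ} (hδ : 0 < δ) (hp : 1 ≤ p) :
    ∃ C : ℝ≥0∞, C ≠ ⊤ ∧ ∀ F D : ℤ → ℝ≥0∞, (∀ k, F k ≤ D k + F (k - 1)) →
      (∑' k : ℤ, ((2:ℝ≥0∞) ^ (-δ * k) * F k) ^ p ≠ ⊤) →
      ∑' k : ℤ, ((2:ℝ≥0∞) ^ (-δ * k) * F k) ^ p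
        ≤ C * ∑' k : ℤ, ((2:ℝ≥0∞) ^ (-δ * k) * D k) ^ p := by
  set L : ℝ≥0∞ := 2 ^ (-δ) with hL
  have hL1 : L < 1 := by
    rw [hL]; exact ENNReal.rpow_lt_one_of_one_lt_of_neg (by norm_num) (by linarith)
  set M := 1 - L with hM
  have hM0 : M ≠ 0 := (tsub_pos_of_lt hL1).ne'
  have hMt : M ≠ ⊤ := ne_top_of_le_ne_top ENNReal.one_ne_top tsub_le_self
  have hML : M + L = 1 := tsub_add_cancel_of_le hL1.le
  have hp0 : 0 ≤ p := by linarith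
  refine ⟨M⁻¹ ^ p, ENNReal.rpow_ne_top_of_nonneg hp0 (ENNReal.inv_ne_top.2 hM0), ?_⟩
  intro F D hFD hS
  set a : ℤ → ℝ≥0∞ := fun k => (2:ℝ≥0∞) ^ (-δ * k) * F k with ha
  set d : ℤ → ℝ≥0∞ := fun k => (2:ℝ≥0∞) ^ (-δ * k) * D k with hd
  have had : ∀ k, a k ^ p ≤ M * (M⁻¹ ^ p * d k ^ p) + L * a (k - 1) ^ p := by
    intro k
    have h1 : a k ≤ M * (M⁻¹ * d k) + L * a (k - 1) := by
      rw [← mul_assoc, ENNReal.mul_inv_cancel hM0 hMt, one_mul]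
      calc a k ≤ (2:ℝ≥0∞) ^ (-δ * k) * (D k + F (k - 1)) := by
            simp only [ha]; gcongr; exact hFD k
        _ = _ := by
            simp only [ha, hd, hL]
            rw [mul_add, ← mul_assoc, aux_two_add]
            congr 3; push_cast; ring
    refine (ENNReal.rpow_le_rpow h1 hp0).trans ?_
    refine (ENNReal.rpow_arith_mean_le_arith_mean2_rpow _ _ _ _ hML hp).trans ?_
    rw [ENNReal.mul_rpow_of_nonneg _ _ hp0]
  set S := ∑' k : ℤ, a k ^ p with hSdef
  set T := ∑' k : ℤ, d k ^ p with hT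
  have hsum : S ≤ M * (M⁻¹ ^ p * T) + L * S := by
    calc S ≤ ∑' k : ℤ, (M * (M⁻¹ ^ p * d k ^ p) + L * a (k - 1) ^ p) := ENNReal.tsum_le_tsum had
      _ = _ := by
        rw [ENNReal.tsum_add, ENNReal.tsum_mul_left, ENNReal.tsum_mul_left, ENNReal.tsum_mul_left]
        congr 2
        exact (Equiv.subRight (1:ℤ)).tsum_eq (fun k : ℤ => a k ^ p)
  have hLS : L * S ≠ ⊤ := ENNReal.mul_ne_top hL1.ne_top hS
  have h2 : M * S + L * S ≤ M * (M⁻¹ ^ p * T) + L * S := by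
    rw [← add_mul, hML, one_mul]; exact hsum
  have h3 : M * S ≤ M * (M⁻¹ ^ p * T) := (ENNReal.add_le_add_iff_right hLS).1 h2
  exact (ENNReal.mul_le_mul_iff_right hM0 hMt).1 h3

lemma aux_Gsum {δ1 p1 γ1 : ℝ} (hp1 : 1 ≤ p1) (h : -δ1 * p1 = γ1 + 1) {g : ℝ → ℝ≥0∞}
    (hg : Measurable g) :
    ∑' k : ℤ, ((2:ℝ≥0∞) ^ (-δ1 * k) * ∫⁻ t, g t ∂(dyM k)) ^ p1
      ≤ (2:ℝ≥0∞) ^ |γ1| * ∫⁻ t in Ioi (0:ℝ), ENNReal.ofReal (t ^ γ1) * g t ^ p1 := by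
  refine le_trans (ENNReal.tsum_le_tsum fun k => ?_) (aux_weight γ1 fun t => g t ^ p1)
  rw [ENNReal.mul_rpow_of_nonneg _ _ (by linarith), ← ENNReal.rpow_mul,
    show -δ1 * k * p1 = (γ1 + 1) * k by rw [← h]; ring]
  gcongr
  exact aux_jensen _ hp1 hg.aemeasurable

lemma aux_geom {c : ℝ} (hc : 0 < c) : ∑' k : ℤ, (2:ℝ≥0∞) ^ (-c * |(k:ℝ)|) ≠ ⊤ := by
  simp_rw [← aux_two_ofReal]
  apply Summable.tsum_ofReal_ne_top
  have key : Summable fun n : ℕ => (2:ℝ) ^ (-c * (n:ℝ)) := by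
    have := summable_geometric_of_lt_one (r := (2:ℝ) ^ (-c)) (by positivity)
      (Real.rpow_lt_one_of_one_lt_of_neg (by norm_num) (by linarith))
    refine this.congr fun n => ?_
    rw [← Real.rpow_natCast, ← Real.rpow_mul (by norm_num)]
  rw [summable_int_iff_summable_nat_and_neg]
  constructor
  · simpa using key
  · simpa using key

lemma aux_fin {δ p : ℝ} (hδ : 0 < δ) (hδ1 : δ < 1) (hp : 0 < p) {F : ℤ → ℝ≥0∞} {M : ℝ≥0∞}
    (hM : M ≠ ⊤) (h1 : ∀ k, F k ≤ M) (h2 : ∀ k : ℤ, F k ≤ M * 2 ^ (k:ℝ)) :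
    ∑' k : ℤ, ((2:ℝ≥0∞) ^ (-δ * k) * F k) ^ p ≠ ⊤ := by
  set c := min δ (1 - δ) with hc
  have hc0 : 0 < c := lt_min hδ (by linarith)
  have hb : ∀ k : ℤ, ((2:ℝ≥0∞) ^ (-δ * k) * F k) ^ p ≤ M ^ p * 2 ^ (-(c * p) * |(k:ℝ)|) := by
    intro k
    have : (2:ℝ≥0∞) ^ (-δ * k) * F k ≤ M * 2 ^ (-c * |(k:ℝ)|) := by
      rcases le_total 0 (k:ℝ) with hk | hk
      · rw [mul_comm]
        refine mul_le_mul' (h1 k) (ENNReal.rpow_le_rpow_of_exponent_le (by norm_num) ?_)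
        rw [abs_of_nonneg hk]
        have : c ≤ δ := min_le_left _ _
        nlinarith
      · calc _ ≤ (2:ℝ≥0∞) ^ (-δ * k) * (M * 2 ^ (k:ℝ)) := by gcongr; exact h2 k
          _ = M * 2 ^ (-δ * k + k) := by rw [← aux_two_add]; ring
          _ ≤ _ := by
            gcongr
            · norm_num
            · rw [abs_of_nonpos hk]
              have : c ≤ 1 - δ := min_le_right _ _
              nlinarith
    calc _ ≤ _ := ENNReal.rpow_le_rpow this hp.le
      _ = _ := by
        rw [ENNReal.mul_rpow_of_nonneg _ _ hp.le, ← ENNReal.rpow_mul]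
        congr 2; ring
  refine ne_top_of_le_ne_top ?_ (ENNReal.tsum_le_tsum hb)
  rw [ENNReal.tsum_mul_left]
  exact ENNReal.mul_ne_top (ENNReal.rpow_ne_top_of_nonneg hp.le hM) (aux_geom (mul_pos hc0 hp))

section
variable {X : Type*} [NormedAddCommGroup X] [NormedSpace ℝ X]

lemma aux_d1 (u : ℝ → X) {k : ℤ} {t τ : ℝ} (ht : t ∈ dyI k) (hτ : τ ∈ dyI (k + 1)) :
    (2:ℝ≥0∞) ^ (-3 : ℝ) * ∫⁻ t', (‖u t' - u t‖₊ : ℝ≥0∞) ∂(dyM (k - 1)) ≤ d1mean u τ t := by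
  have hτ0 := dyI_pos hτ
  have hτ2 : τ < (2:ℝ) ^ ((k:ℝ) + 2) := by
    have := hτ.2
    push_cast at this
    rwa [show (k:ℝ) + 1 + 1 = k + 2 by ring] at this
  have hτ1 : (2:ℝ) ^ ((k:ℝ) + 1) ≤ τ := by simpa using hτ.1
  have hi : (2:ℝ≥0∞) ^ (-((k:ℝ) + 2)) ≤ ENNReal.ofReal τ⁻¹ := by
    rw [← aux_two_ofReal, Real.rpow_neg (by norm_num)]
    exact ENNReal.ofReal_le_ofReal (inv_anti₀ hτ0 hτ2.le)
  have hset : ∫⁻ t' in dyI (k - 1), (‖u t' - u t‖₊ : ℝ≥0∞)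
      ≤ ∫⁻ h in {h : ℝ | |h| < τ ∧ 0 < t + h}, (‖u (t + h) - u t‖₊ : ℝ≥0∞) := by
    rw [← lintegral_indicator (dyI_meas _),
      ← lintegral_add_left_eq_self _ t]
    have hms : MeasurableSet {h : ℝ | |h| < τ ∧ 0 < t + h} :=
      (measurableSet_lt (f := fun h : ℝ => |h|) (g := fun _ => τ) (by fun_prop) (by fun_prop)).inter
        (measurableSet_lt (f := fun _ : ℝ => (0:ℝ)) (g := fun h => t + h) (by fun_prop) (by fun_prop))
    rw [← lintegral_indicator hms]
    refine lintegral_mono fun h => ?_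
    by_cases hh : t + h ∈ dyI (k - 1)
    · have hmem : h ∈ {h : ℝ | |h| < τ ∧ 0 < t + h} := by
        have hpos := dyI_pos hh
        refine ⟨?_, hpos⟩
        have h1 := hh.2
        push_cast at h1
        rw [sub_add_cancel] at h1
        have h2 := ht.1
        have h3 := ht.2
        rw [abs_lt]; constructor <;> linarith
      rw [Set.indicator_of_mem hh, Set.indicator_of_mem hmem]
    · rw [Set.indicator_of_notMem hh]; exact bot_le
  rw [d1mean]
  calc _ = (2:ℝ≥0∞) ^ (-((k:ℝ) + 2)) * ∫⁻ t' in dyI (k - 1), (‖u t' - u t‖₊ : ℝ≥0∞) := by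
        rw [dyM_int', ← mul_assoc, aux_two_add]
        congr 2; push_cast; ring
    _ ≤ _ := by gcongr

lemma aux_inner (u : ℝ → X) {s p : ℝ} (hs : 0 ≤ s) (hp : 0 ≤ p) {k : ℤ} {t : ℝ} (ht : t ∈ dyI k) :
    ((2:ℝ≥0∞) ^ (-s * k) * ∫⁻ t', (‖u t' - u t‖₊ : ℝ≥0∞) ∂(dyM (k - 1))) ^ p
      ≤ 2 ^ ((2 * s + 3) * p + 1) * ∫⁻ τ in Ioi (0:ℝ),
        (ENNReal.ofReal (τ ^ (-s)) * d1mean u τ t) ^ p * (ENNReal.ofReal τ)⁻¹ := by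
  set E := ∫⁻ t', (‖u t' - u t‖₊ : ℝ≥0∞) ∂(dyM (k - 1)) with hE
  have hlow : (2:ℝ≥0∞) ^ (-((2 * s + 3) * p + 1)) * ((2:ℝ≥0∞) ^ (-s * k) * E) ^ p
      ≤ ∫⁻ τ in Ioi (0:ℝ),
        (ENNReal.ofReal (τ ^ (-s)) * d1mean u τ t) ^ p * (ENNReal.ofReal τ)⁻¹ := by
    calc _ = ∫⁻ τ in dyI (k + 1), ((2:ℝ≥0∞) ^ (-s * (k + 2)) * (2 ^ (-3 : ℝ) * E)) ^ p
            * 2 ^ (-((k:ℝ) + 2)) := by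
          rw [setLIntegral_const, dyI_vol]
          simp only [ENNReal.mul_rpow_of_nonneg _ _ hp, ← ENNReal.rpow_mul]
          have : (2:ℝ≥0∞) ^ (-((2 * s + 3) * p + 1)) * 2 ^ (-s * k * p) =
            2 ^ (-s * (k + 2) * p) * 2 ^ (-3 * p) * 2 ^ (-((k:ℝ) + 2)) * 2 ^ (((k + 1 : ℤ)) : ℝ) := by
            simp only [aux_two_add]
            congr 1; push_cast; ring
          rw [← mul_assoc, this]; ring
      _ ≤ ∫⁻ τ in dyI (k + 1),
        (ENNReal.ofReal (τ ^ (-s)) * d1mean u τ t) ^ p * (ENNReal.ofReal τ)⁻¹ := by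
          refine setLIntegral_mono' (dyI_meas _) fun τ hτ => ?_
          have hτ0 := dyI_pos hτ
          have hτ2 : τ < (2:ℝ) ^ ((k:ℝ) + 2) := by
            have := hτ.2
            push_cast at this
            rwa [show (k:ℝ) + 1 + 1 = k + 2 by ring] at this
          gcongr
          · rw [← aux_two_ofReal]
            apply ENNReal.ofReal_le_ofReal
            rw [show -s * ((k:ℝ) + 2) = (k + 2) * (-s) by ring, Real.rpow_mul (by norm_num)]
            exact Real.rpow_le_rpow_of_nonpos hτ0 hτ2.le (by linarith)
          · exact aux_d1 u ht hτ
          · rw [← ENNReal.ofReal_inv_of_pos hτ0, ← aux_two_ofReal, Real.rpow_neg (by norm_num)]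
            exact ENNReal.ofReal_le_ofReal (inv_anti₀ hτ0 hτ2.le)
      _ ≤ _ := lintegral_mono_set fun τ hτ => dyI_pos hτ
  calc _ = (2:ℝ≥0∞) ^ ((2 * s + 3) * p + 1) * ((2:ℝ≥0∞) ^ (-((2 * s + 3) * p + 1)) *
        ((2:ℝ≥0∞) ^ (-s * k) * E) ^ p) := by
        rw [← mul_assoc, aux_two_add]; simp
    _ ≤ _ := by gcongr

lemma aux_Fsum {s p γ δ : ℝ} (hs : 0 ≤ s) (hp : 1 ≤ p) (hδ : 0 < δ) (hδ1 : δ < 1)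
    (h : -δ * p = γ + 1 - s * p) :
    ∃ C : ℝ≥0∞, C ≠ ⊤ ∧ ∀ u : ℝ → X, Continuous u → ∀ M : ℝ≥0∞, M ≠ ⊤ →
      (∀ k : ℤ, ∫⁻ t, (‖u 0 - u t‖₊ : ℝ≥0∞) ∂(dyM k) ≤ M) →
      (∀ k : ℤ, ∫⁻ t, (‖u 0 - u t‖₊ : ℝ≥0∞) ∂(dyM k) ≤ M * 2 ^ (k:ℝ)) →
      ∑' k : ℤ, ((2:ℝ≥0∞) ^ (-δ * k) * ∫⁻ t, (‖u 0 - u t‖₊ : ℝ≥0∞) ∂(dyM k)) ^ p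
        ≤ C * ∫⁻ t in Ioi (0:ℝ), ENNReal.ofReal (t ^ γ) *
          (∫⁻ τ in Ioi (0:ℝ),
            (ENNReal.ofReal (τ ^ (-s)) * d1mean u τ t) ^ p * (ENNReal.ofReal τ)⁻¹) := by
  obtain ⟨C, hC, hH⟩ := aux_hardy hδ hp
  refine ⟨C * (2 ^ ((2 * s + 3) * p + 1) * 2 ^ |γ|), ENNReal.mul_ne_top hC
    (ENNReal.mul_ne_top (aux_two_rpow_ne_top _) (aux_two_rpow_ne_top _)), ?_⟩
  intro u hu M hM hM1 hM2
  have hp0 : 0 ≤ p := by linarith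
  set E : ℤ → ℝ → ℝ≥0∞ := fun k t => ∫⁻ t', (‖u t' - u t‖₊ : ℝ≥0∞) ∂(dyM (k - 1)) with hE
  have hEm : ∀ k, Measurable (E k) := by
    intro k
    refine Measurable.lintegral_prod_right' (ν := dyM (k - 1))
      (f := fun q : ℝ × ℝ => (‖u q.2 - u q.1‖₊ : ℝ≥0∞)) ?_
    apply Continuous.measurable
    fun_prop
  have hgm : Measurable fun t => (‖u 0 - u t‖₊ : ℝ≥0∞) := by
    apply Continuous.measurable
    fun_prop
  have hrec : ∀ k : ℤ, ∫⁻ t, (‖u 0 - u t‖₊ : ℝ≥0∞) ∂(dyM k) ≤ ∫⁻ t, E k t ∂(dyM k)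
      + ∫⁻ t, (‖u 0 - u t‖₊ : ℝ≥0∞) ∂(dyM (k - 1)) := by
    intro k
    have hpt : ∀ t, (‖u 0 - u t‖₊ : ℝ≥0∞) ≤ E k t
        + ∫⁻ t', (‖u 0 - u t'‖₊ : ℝ≥0∞) ∂(dyM (k - 1)) := by
      intro t
      have hm : Measurable fun t' => (‖u t' - u t‖₊ : ℝ≥0∞) := by
        apply Continuous.measurable
        fun_prop
      calc (‖u 0 - u t‖₊ : ℝ≥0∞) = ∫⁻ t', (‖u 0 - u t‖₊ : ℝ≥0∞) ∂(dyM (k - 1)) := by simp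
        _ ≤ ∫⁻ t', ((‖u t' - u t‖₊ : ℝ≥0∞) + (‖u 0 - u t'‖₊ : ℝ≥0∞)) ∂(dyM (k - 1)) := by
            refine lintegral_mono fun t' => ?_
            dsimp only
            rw [add_comm]
            have := nnnorm_add_le (u 0 - u t') (u t' - u t)
            rw [sub_add_sub_cancel] at this
            exact_mod_cast this
        _ = _ := lintegral_add_left hm _
    calc _ ≤ _ := lintegral_mono hpt
      _ = _ := by rw [lintegral_add_left (hEm k)]; simp
  refine (hH _ (fun k => ∫⁻ t, E k t ∂(dyM k)) hrec
    (aux_fin hδ hδ1 (by linarith) hM hM1 hM2)).trans ?_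
  rw [mul_assoc, mul_assoc]
  gcongr
  refine le_trans ?_ (mul_le_mul' le_rfl (aux_weight γ _))
  rw [← ENNReal.tsum_mul_left]
  refine ENNReal.tsum_le_tsum fun k => ?_
  calc ((2:ℝ≥0∞) ^ (-δ * k) * ∫⁻ t, E k t ∂(dyM k)) ^ p
      ≤ 2 ^ ((γ + 1) * k) * ((2:ℝ≥0∞) ^ (-s * k * p) * ∫⁻ t, E k t ^ p ∂(dyM k)) := by
        rw [ENNReal.mul_rpow_of_nonneg _ _ hp0, ← ENNReal.rpow_mul, ← mul_assoc, aux_two_add,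
          show -δ * k * p = (γ + 1) * k + -s * k * p by linear_combination (k:ℝ) * h]
        gcongr
        exact aux_jensen _ hp (hEm k).aemeasurable
    _ = 2 ^ ((γ + 1) * k) * ∫⁻ t, ((2:ℝ≥0∞) ^ (-s * k) * E k t) ^ p ∂(dyM k) := by
        rw [← lintegral_const_mul' _ _ (aux_two_rpow_ne_top _)]
        simp only [ENNReal.mul_rpow_of_nonneg _ _ hp0, ← ENNReal.rpow_mul]
    _ ≤ 2 ^ ((γ + 1) * k) * ∫⁻ t, 2 ^ ((2 * s + 3) * p + 1) * (∫⁻ τ in Ioi (0:ℝ),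
        (ENNReal.ofReal (τ ^ (-s)) * d1mean u τ t) ^ p * (ENNReal.ofReal τ)⁻¹) ∂(dyM k) := by
        gcongr 1
        exact lintegral_mono_ae (dyM_ae fun t ht => aux_inner u hs hp0 ht)
    _ = _ := by
        rw [lintegral_const_mul' _ _ (aux_two_rpow_ne_top _)]
        ring

lemma aux_schwartz_F (u : SchwartzMap ℝ X) : ∃ M : ℝ≥0∞, M ≠ ⊤ ∧
      (∀ k : ℤ, ∫⁻ t, (‖u 0 - u t‖₊ : ℝ≥0∞) ∂(dyM k) ≤ M) ∧
      (∀ k : ℤ, ∫⁻ t, (‖u 0 - u t‖₊ : ℝ≥0∞) ∂(dyM k) ≤ M * 2 ^ (k:ℝ)) := by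
  obtain ⟨A, hA, hA'⟩ := u.decay 0 0
  obtain ⟨B, hB, hB'⟩ := u.decay 0 1
  simp only [pow_zero, one_mul, norm_iteratedFDeriv_zero] at hA'
  simp only [pow_zero, one_mul, norm_iteratedFDeriv_one] at hB'
  have hLip : ∀ t, ‖u 0 - u t‖ ≤ B * |t| := by
    intro t
    have := Convex.norm_image_sub_le_of_norm_fderiv_le (𝕜 := ℝ) (f := u) (s := univ)
      (fun x _ => u.differentiableAt) (fun x _ => hB' x) convex_univ (mem_univ t) (mem_univ 0)
    simpa using this
  have toE : ∀ (t : ℝ) (c : ℝ), ‖u 0 - u t‖ ≤ c → (‖u 0 - u t‖₊ : ℝ≥0∞) ≤ ENNReal.ofReal c := by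
    intro t c h
    rw [← enorm_eq_nnnorm, ← ofReal_norm]
    exact ENNReal.ofReal_le_ofReal h
  refine ⟨ENNReal.ofReal (2 * A + 2 * B), ENNReal.ofReal_ne_top, fun k => ?_, fun k => ?_⟩
  · calc _ ≤ ∫⁻ t, ENNReal.ofReal (2 * A + 2 * B) ∂(dyM k) := by
          refine lintegral_mono fun t => toE t _ ?_
          have := norm_sub_le (u 0) (u t)
          linarith [hA' 0, hA' t]
      _ = _ := by simp
  · calc _ ≤ ∫⁻ t, ENNReal.ofReal (2 * A + 2 * B) * 2 ^ (k:ℝ) ∂(dyM k) := by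
          refine lintegral_mono_ae (dyM_ae fun t ht => ?_)
          rw [← aux_two_ofReal, ← ENNReal.ofReal_mul (by positivity)]
          refine toE t _ ((hLip t).trans ?_)
          rw [abs_of_pos (dyI_pos ht)]
          have h2 := ht.2
          rw [Real.rpow_add (by norm_num), Real.rpow_one] at h2
          have : (0:ℝ) < 2 ^ (k:ℝ) := by positivity
          nlinarith
      _ = _ := by simp

lemma aux_schwartz_G (u : SchwartzMap ℝ X) : ∃ M : ℝ≥0∞, M ≠ ⊤ ∧
      (∀ k : ℤ, ∫⁻ t, (‖u t‖₊ : ℝ≥0∞) ∂(dyM k) ≤ M * 2 ^ (-(k:ℝ))) := by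
  obtain ⟨A, hA, hA'⟩ := u.decay 1 0
  simp only [pow_one, norm_iteratedFDeriv_zero] at hA'
  refine ⟨ENNReal.ofReal A, ENNReal.ofReal_ne_top, fun k => ?_⟩
  calc _ ≤ ∫⁻ t, ENNReal.ofReal A * 2 ^ (-(k:ℝ)) ∂(dyM k) := by
        refine lintegral_mono_ae (dyM_ae fun t ht => ?_)
        rw [← aux_two_ofReal, ← ENNReal.ofReal_mul (by positivity), ← enorm_eq_nnnorm,
          ← ofReal_norm]
        apply ENNReal.ofReal_le_ofReal
        have h1 := hA' t
        rw [Real.norm_of_nonneg (dyI_pos ht).le] at h1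
        have : (0:ℝ) < 2 ^ (k:ℝ) := by positivity
        rw [Real.rpow_neg (by norm_num), ← div_eq_mul_inv, le_div_iff₀ this]
        have := ht.1
        nlinarith [norm_nonneg (u t)]
    _ = _ := by simp

lemma aux_lim : Filter.Tendsto (fun k : ℤ => (2:ℝ≥0∞) ^ (-(k:ℝ))) Filter.atTop (nhds 0) := by
  simp_rw [← aux_two_ofReal]
  rw [← ENNReal.ofReal_zero]
  refine (ENNReal.continuous_ofReal.tendsto 0).comp ?_
  have h := (tendsto_rpow_atTop_of_base_lt_one (1 / 2 : ℝ) (by norm_num) (by norm_num)).comp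
    (tendsto_intCast_atTop_atTop (R := ℝ))
  refine h.congr fun k => ?_
  simp only [Function.comp]
  rw [Real.rpow_neg (by norm_num), one_div, Real.inv_rpow (by norm_num)]

end

/-- **Key trace estimate.** With `δ_0 = s_0 - (1+γ_0)/p_0 > 0`, `δ_1 = -(1+γ_1)/p_1`,
`θ = δ_0/(δ_0-δ_1)` and `1/p = (1-θ)/p_0 + θ/p_1`, for every Schwartz function `u`
with values in `X_0 ∩ X_1` one has
`‖u(0)‖_{(X_0,X_1)_{θ,p}} ≲ ([u]^{(1)}_{F^{s_0}_{p_0,p_0}(ℝ_+,w_{γ_0};X_0)})^{1-θ}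
(‖u‖_{L^{p_1}(ℝ_+,w_{γ_1};X_1)})^θ`. -/
theorem trace_estimate_simple_case
    [TopologicalSpace V] [T2Space V]
    (i0 : X0 →ₗ[ℝ] V) (i1 : X1 →ₗ[ℝ] V)
    (hi0 : Continuous i0) (hi1 : Continuous i1)
    (hinj0 : Function.Injective i0) (hinj1 : Function.Injective i1)
    (s0 p0 p1 γ0 γ1 δ0 δ1 θ p : ℝ)
    (hs0 : s0 ∈ Ioo (0:ℝ) 1) (hp0 : 1 < p0) (hp1 : 1 < p1)
    (hγ0 : γ0 ∈ Ioo (-1 : ℝ) (p0 - 1)) (hγ1 : γ1 ∈ Ioo (-1 : ℝ) (p1 - 1))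
    (hδ0 : δ0 = s0 - (1 + γ0) / p0) (hδ1 : δ1 = -(1 + γ1) / p1)
    (hδ0pos : 0 < δ0)
    (hθ : θ = δ0 / (δ0 - δ1)) (hp : 1 / p = (1 - θ) / p0 + θ / p1) :
    ∃ C : ℝ≥0∞, C ≠ ⊤ ∧
      ∀ (u0 : SchwartzMap ℝ X0) (u1 : SchwartzMap ℝ X1),
        (∀ t : ℝ, i0 (u0 t) = i1 (u1 t)) →
        interpNorm i0 i1 θ p (i0 (u0 0)) ≤
          C * (diffSeminormF s0 p0 γ0 (fun t => u0 t)) ^ (1 - θ)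
            * (wLpNorm p1 γ1 (fun t => u1 t)) ^ θ := by
  have hδ1neg : δ1 < 0 := by
    rw [hδ1]
    exact div_neg_of_neg_of_pos (by linarith [hγ1.1]) (by linarith)
  have hd : 0 < δ0 - δ1 := by linarith
  have hθ0 : 0 < θ := by rw [hθ]; positivity
  have hθ1 : θ < 1 := by rw [hθ, div_lt_one hd]; linarith
  have hp0' : 0 < p0 := by linarith
  have hp1' : 0 < p1 := by linarith
  have hppos : 0 < p := by
    have : 0 < (1 - θ) / p0 + θ / p1 :=
      add_pos (div_pos (by linarith) hp0') (div_pos hθ0 hp1')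
    rw [← hp] at this
    exact one_div_pos.1 this
  have hδrel : (1 - θ) * δ0 + θ * δ1 = 0 := by
    rw [hθ]; field_simp; ring
  have hδ0lt : δ0 < 1 := by
    have : 0 < (1 + γ0) / p0 := div_pos (by linarith [hγ0.1]) hp0'
    rw [hδ0]; linarith [hs0.2]
  have e0 : -δ0 * p0 = γ0 + 1 - s0 * p0 := by rw [hδ0]; field_simp; ring
  have e1 : -δ1 * p1 = γ1 + 1 := by rw [hδ1]; field_simp; ring
  obtain ⟨C1, hC1, H1⟩ := aux_abs (δ0 := δ0) (δ1 := δ1) hθ0 hθ1 hp0' hp1' hppos hδrel hp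
  obtain ⟨C2, hC2, H2⟩ := aux_Fsum (X := X0) hs0.1.le hp0.le hδ0pos hδ0lt e0
  have hq0 : 0 ≤ (1 - θ) / p0 := div_nonneg (by linarith) hp0'.le
  have hq1 : 0 ≤ θ / p1 := div_nonneg hθ0.le hp1'.le
  refine ⟨C1 * C2 ^ ((1 - θ) / p0) * ((2:ℝ≥0∞) ^ |γ1|) ^ (θ / p1), ?_, ?_⟩
  · exact ENNReal.mul_ne_top (ENNReal.mul_ne_top hC1 (ENNReal.rpow_ne_top_of_nonneg hq0 hC2))
      (ENNReal.rpow_ne_top_of_nonneg hq1 (aux_two_rpow_ne_top _))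
  intro u0 u1 hu
  obtain ⟨M, hM, hM1, hM2⟩ := aux_schwartz_F u0
  obtain ⟨N, hN, hN1⟩ := aux_schwartz_G u1
  have hK : ∀ (r : ℝ) (k : ℤ), Kfun i0 i1 r (i0 (u0 0)) ≤
      (∫⁻ t, (‖u0 0 - u0 t‖₊ : ℝ≥0∞) ∂(dyM k))
        + ENNReal.ofReal r * ∫⁻ t, (‖u1 t‖₊ : ℝ≥0∞) ∂(dyM k) := by
    intro r k
    have hm : Measurable fun t => (‖u0 0 - u0 t‖₊ : ℝ≥0∞) := by
      apply Continuous.measurable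
      fun_prop
    rw [← lintegral_const_mul' _ _ ENNReal.ofReal_ne_top, ← lintegral_add_left hm]
    calc Kfun i0 i1 r (i0 (u0 0)) = ∫⁻ _, Kfun i0 i1 r (i0 (u0 0)) ∂(dyM k) := by simp
      _ ≤ _ := by
        refine lintegral_mono fun t => ?_
        refine iInf_le_of_le (u0 0 - u0 t) (iInf_le_of_le (u1 t) (iInf_le_of_le ?_ le_rfl))
        rw [← hu t, ← map_add, sub_add_cancel]
  have hlimF : Filter.Tendsto (fun k : ℤ => ∫⁻ t, (‖u0 0 - u0 t‖₊ : ℝ≥0∞) ∂(dyM k))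
      Filter.atBot (nhds 0) := by
    have h1 := ENNReal.Tendsto.const_mul (a := M)
      (aux_lim.comp Filter.tendsto_neg_atBot_atTop) (Or.inr hM)
    rw [mul_zero] at h1
    refine tendsto_of_tendsto_of_tendsto_of_le_of_le tendsto_const_nhds h1 (fun _ => bot_le) ?_
    intro k
    simpa using hM2 k
  have hlimG : Filter.Tendsto (fun k : ℤ => ∫⁻ t, (‖u1 t‖₊ : ℝ≥0∞) ∂(dyM k))
      Filter.atTop (nhds 0) := by
    have h1 := ENNReal.Tendsto.const_mul (a := N) aux_lim (Or.inr hN)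
    rw [mul_zero] at h1
    exact tendsto_of_tendsto_of_tendsto_of_le_of_le tendsto_const_nhds h1 (fun _ => bot_le) hN1
  have main := H1 (fun r => Kfun i0 i1 r (i0 (u0 0))) _ _
    (fun k => ne_top_of_le_ne_top hM (hM1 k))
    (fun k => ne_top_of_le_ne_top (ENNReal.mul_ne_top hN (aux_two_rpow_ne_top _)) (hN1 k))
    hlimF hlimG hK
  have hFs := H2 (fun t => u0 t) u0.continuous M hM hM1 hM2
  have hGm : Measurable fun t => (‖u1 t‖₊ : ℝ≥0∞) := by
    apply Continuous.measurable
    fun_prop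
  have hGs := aux_Gsum hp1.le e1 hGm
  rw [interpNorm]
  refine main.trans ?_
  refine (mul_le_mul' (mul_le_mul' le_rfl (ENNReal.rpow_le_rpow hFs hq0))
    (ENNReal.rpow_le_rpow hGs hq1)).trans (le_of_eq ?_)
  rw [diffSeminormF, wLpNorm, ← ENNReal.rpow_mul _ (1 / p0), ← ENNReal.rpow_mul _ (1 / p1),
    ENNReal.mul_rpow_of_nonneg _ _ hq0, ENNReal.mul_rpow_of_nonneg _ _ hq1,
    one_div_mul_eq_div, one_div_mul_eq_div]
  ring
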